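/- There exist δ_g > 0 depending only on g and, for each λ > 1, a constant C and a threshold n₀, such that for every integer n ≥ n₀ and every finite set r of positive integers ≤ n with |r| ≤ 2g+4: ∑_{x ∈ T_n^{ind}} (∏_{i=1}^{2g+4} x_i^{-α}) · |{ {y₁, y₂, y₃} ∈ C_{r, x̃}(n) : {y₁, y₂, y₃} ∩ {x₁, x₂, x₃} = ∅ }| ≤ C · n^{-δ_g}, where for x = (x₁, …, x_{2g+4}) one writes x̃ = (x₄, …, x_{2g+4}), so that Set(x̃) = {x₄, …, x_{2g+4}}. The constants are independent of r. -/

import Mathlib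

noncomputable section

open Real MeasureTheory ProbabilityTheory

def IsSidonZ {M : ℕ} (S : Set (ZMod M)) : Prop :=
  ∀ a ∈ S, ∀ b ∈ S, ∀ c ∈ S, ∀ d ∈ S, a + b = c + d → ({a, b} : Set (ZMod M)) = {c, d}

def Covers3 {M : ℕ} (S : Set (ZMod M)) : Prop :=
  ∀ z : ZMod M, ∃ s₁ ∈ S, ∃ s₂ ∈ S, ∃ s₃ ∈ S,
    s₁ ≠ s₂ ∧ s₁ ≠ s₃ ∧ s₂ ≠ s₃ ∧ z = s₁ + s₂ + s₃

def alph (g : ℕ) : ℝ := ((g : ℝ) + 1) / (2 * (g : ℝ) + 1)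

def glam (g : ℕ) (lam : ℝ) (n : ℕ) : ℝ :=
  lam ^ ((2 * (g : ℝ) + 5) / (1 - alph g)) * (n : ℝ) ^ ((1 : ℝ) / (g : ℝ)) *
    Real.log n ^ ((1 : ℝ) / (1 - alph g))

def GoodS (M : ℕ) (CM : Set (ZMod M)) (s : ℕ → Fin 3 → ZMod M) : Prop :=
  ∀ n : ℕ, (∀ i, s n i ∈ CM) ∧ s n 0 ≠ s n 1 ∧ s n 0 ≠ s n 2 ∧ s n 1 ≠ s n 2 ∧
    s n 0 + s n 1 + s n 2 = (n : ZMod M)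

def Rtrip (g M : ℕ) (lam : ℝ) (s : ℕ → Fin 3 → ZMod M) (n x₁ x₂ x₃ : ℕ) : Prop :=
  0 < x₁ ∧ 0 < x₂ ∧ 0 < x₃ ∧ x₁ + x₂ + x₃ = n ∧
  glam g lam n / 2 ≤ (x₁ : ℝ) ∧ (x₁ : ℝ) ≤ glam g lam n ∧
  (n : ℝ) / 4 ≤ (x₂ : ℝ) ∧ x₂ ≤ n ∧ (n : ℝ) / 4 ≤ (x₃ : ℝ) ∧ x₃ ≤ n ∧
  (x₁ : ZMod M) = s n 0 ∧ (x₂ : ZMod M) = s n 1 ∧ (x₃ : ZMod M) = s n 2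

def Rn (g M : ℕ) (lam : ℝ) (s : ℕ → Fin 3 → ZMod M) (n : ℕ) : Set (Finset ℕ) :=
  {ω | ∃ x₁ x₂ x₃ : ℕ, ω = {x₁, x₂, x₃} ∧ Rtrip g M lam s n x₁ x₂ x₃}

def imgF {m : ℕ} (x : Fin m → ℕ) : Finset ℕ := Finset.image x Finset.univ

def firstThree (g : ℕ) (x : Fin (2 * g + 4) → ℕ) : Finset ℕ :=
  {x ⟨0, by omega⟩, x ⟨1, by omega⟩, x ⟨2, by omega⟩}

def pairOf (g : ℕ) (x : Fin (2 * g + 4) → ℕ) (j : ℕ) : Finset ℕ :=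
  if j = 0 then {x ⟨0, by omega⟩, x ⟨3, by omega⟩}
  else if h : j ≤ g then {x ⟨2 * j + 2, by omega⟩, x ⟨2 * j + 3, by omega⟩}
  else ∅

def Tn (g M : ℕ) (lam : ℝ) (s : ℕ → Fin 3 → ZMod M) (n : ℕ) :
    Set (Fin (2 * g + 4) → ℕ) :=
  {x | (∀ i, 0 < x i) ∧
    firstThree g x ∈ Rn g M lam s n ∧
    (∀ j : ℕ, 2 ≤ j → ∀ _ : j ≤ g + 1,
      x ⟨0, by omega⟩ + x ⟨3, by omega⟩ = x ⟨2 * j, by omega⟩ + x ⟨2 * j + 1, by omega⟩) ∧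
    (∀ i : Fin (2 * g + 4), 3 ≤ (i : ℕ) → x i ≤ x ⟨0, by omega⟩) ∧
    (∀ k : ℕ, 2 ≤ k → ∀ _ : k ≤ g + 1,
      (x ⟨2 * k, by omega⟩ : ZMod M) = (x ⟨0, by omega⟩ : ZMod M) ∧
      (x ⟨2 * k + 1, by omega⟩ : ZMod M) = (x ⟨3, by omega⟩ : ZMod M)) ∧
    (∀ j k : ℕ, j ≤ g → k ≤ g → j ≠ k → pairOf g x j ≠ pairOf g x k)}

def TnInd (g M : ℕ) (lam : ℝ) (s : ℕ → Fin 3 → ZMod M) (n : ℕ) :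
    Set (Fin (2 * g + 4) → ℕ) :=
  {x ∈ Tn g M lam s n | Function.Injective x}

def TnDep (g M : ℕ) (lam : ℝ) (s : ℕ → Fin 3 → ZMod M) (n : ℕ) :
    Set (Fin (2 * g + 4) → ℕ) :=
  {x ∈ Tn g M lam s n | ¬ Function.Injective x}

def Vr (g : ℕ) (r₁ : ℕ) : Set (Fin (2 * g + 1) → ℕ) :=
  {v | (∀ i, 0 < v i) ∧
    (∀ t : ℕ, ∀ _ : t < g,
      r₁ + v ⟨0, by omega⟩ = v ⟨2 * t + 1, by omega⟩ + v ⟨2 * t + 2, by omega⟩) ∧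
    (∀ i, v i ≤ r₁) ∧ Function.Injective v ∧ (∀ i, v i ≠ r₁)}

def Tcal (X r : Finset ℕ) (k : ℕ) (eps : ℕ → ℤ) : Set (ℕ → ℕ) :=
  {y | (∀ j < k, y j ∈ X ∪ r) ∧ (∀ j, k ≤ j → y j = 0) ∧ (∃ j < k, y j ∈ X) ∧
    (∀ i < k, ∀ j < k, y i = y j → eps i = eps j)}

def Fval (k : ℕ) (eps : ℕ → ℤ) (y : ℕ → ℕ) : ℤ :=
  ∑ j ∈ Finset.range k, eps j * (y j : ℤ)

def Ccal (U X r : Finset ℕ) : Set (Finset ℕ) :=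
  {w | w.card = 4 ∧ w ⊆ U ∧ (∃ a ∈ w, a ∈ X ∧ a ∉ r) ∧
    ∃ y₁ y₂ y₃ y₄ : ℕ, w = {y₁, y₂, y₃, y₄} ∧ y₁ + y₂ = y₃ + y₄ ∧
      ({y₁, y₂} : Finset ℕ) ≠ {y₃, y₄}}

def CcalR (g M : ℕ) (lam : ℝ) (s : ℕ → Fin 3 → ZMod M) (n : ℕ) (X r : Finset ℕ) :
    Set (Finset ℕ) :=
  {w | w ∈ Rn g M lam s n ∧ w ⊆ X ∪ r ∧ ∃ a ∈ w, a ∈ X ∧ a ∉ r}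

def Sx (g : ℕ) (x : Fin (2 * g + 4) → ℕ) : Set (Finset ℕ) :=
  {w | ∃ l : ℕ, ∃ _ : 3 ≤ l, ∃ _ : l ≤ g + 2,
      w = ({x ⟨0, by omega⟩, x ⟨3, by omega⟩,
            x ⟨2 * l - 2, by omega⟩, x ⟨2 * l - 1, by omega⟩} : Finset ℕ)} ∪
  {w | ∃ l j : ℕ, ∃ _ : 3 ≤ l, ∃ _ : l < j, ∃ _ : j ≤ g + 2,
      w = ({x ⟨2 * j - 2, by omega⟩, x ⟨2 * j - 1, by omega⟩,
            x ⟨2 * l - 2, by omega⟩, x ⟨2 * l - 1, by omega⟩} : Finset ℕ)}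

def SxV (g : ℕ) (r₁ : ℕ) (v : Fin (2 * g + 1) → ℕ) : Set (Finset ℕ) :=
  {w | ∃ l : ℕ, ∃ _ : 3 ≤ l, ∃ _ : l ≤ g + 2,
      w = ({r₁, v ⟨0, by omega⟩, v ⟨2 * l - 5, by omega⟩, v ⟨2 * l - 4, by omega⟩} : Finset ℕ)} ∪
  {w | ∃ l j : ℕ, ∃ _ : 3 ≤ l, ∃ _ : l < j, ∃ _ : j ≤ g + 2,
      w = ({v ⟨2 * j - 5, by omega⟩, v ⟨2 * j - 4, by omega⟩,
            v ⟨2 * l - 5, by omega⟩, v ⟨2 * l - 4, by omega⟩} : Finset ℕ)}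

def tailSet (g : ℕ) (x : Fin (2 * g + 4) → ℕ) : Finset ℕ :=
  Finset.image (fun i : Fin (2 * g + 1) => x ⟨(i : ℕ) + 3, by have := i.isLt; omega⟩)
    Finset.univ

lemma alph_lt_one {g : ℕ} (hg : 0 < g) : alph g < 1 := by
  have : (0 : ℝ) < g := by exact_mod_cast hg
  rw [alph, div_lt_one (by positivity)]
  linarith

lemma alph_pos (g : ℕ) : 0 < alph g := by
  unfold alph
  positivity

/-- A power sum with exponent in `(-1, 0)` is at most its integral comparison. -/
lemma sum_Icc_rpow_neg_le {α : ℝ} (h0 : 0 < α) (h1 : α < 1) (a : ℕ) :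
    ∑ u ∈ Finset.Icc 1 a, (u : ℝ) ^ (-α) ≤ 1 / (1 - α) * (a : ℝ) ^ (1 - α) := by
  have h1' : 0 < 1 - α := by linarith
  induction a with
  | zero => simp [Real.zero_rpow h1'.ne']
  | succ a ih =>
    rw [Finset.sum_Icc_succ_top (by omega)]
    have hp : (0 : ℝ) < ((a + 1 : ℕ) : ℝ) := by positivity
    have hle : -1 ≤ -(1 / ((a + 1 : ℕ) : ℝ)) := by
      have : 1 / ((a + 1 : ℕ) : ℝ) ≤ 1 := by
        rw [div_le_one hp]
        push_cast
        linarith [(Nat.cast_nonneg a : (0 : ℝ) ≤ a)]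
      linarith
    have hb := rpow_one_add_le_one_add_mul_self hle h1'.le (by linarith : 1 - α ≤ 1)
    have ha : (a : ℝ) = ((a + 1 : ℕ) : ℝ) * (1 + -(1 / ((a + 1 : ℕ) : ℝ))) := by
      field_simp
      push_cast
      ring
    have hmul : (a : ℝ) ^ (1 - α) ≤
        ((a + 1 : ℕ) : ℝ) ^ (1 - α) * (1 + (1 - α) * -(1 / ((a + 1 : ℕ) : ℝ))) := by
      conv_lhs => rw [ha]
      rw [Real.mul_rpow hp.le (by linarith)]
      gcongr
    have hs : ((a + 1 : ℕ) : ℝ) ^ (-α) =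
        ((a + 1 : ℕ) : ℝ) ^ (1 - α) * (1 / ((a + 1 : ℕ) : ℝ)) := by
      rw [one_div, ← Real.rpow_neg_one, ← Real.rpow_add hp]
      congr 1
      ring
    have hd : 1 / (1 - α) * (a : ℝ) ^ (1 - α) ≤ 1 / (1 - α) *
        (((a + 1 : ℕ) : ℝ) ^ (1 - α) * (1 + (1 - α) * -(1 / ((a + 1 : ℕ) : ℝ)))) := by
      gcongr
    have he : 1 / (1 - α) *
        (((a + 1 : ℕ) : ℝ) ^ (1 - α) * (1 + (1 - α) * -(1 / ((a + 1 : ℕ) : ℝ)))) =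
        1 / (1 - α) * ((a + 1 : ℕ) : ℝ) ^ (1 - α) - ((a + 1 : ℕ) : ℝ) ^ (-α) := by
      rw [hs]
      field_simp
      ring
    linarith

lemma sum_Icc_rpow_neg_reflect (α : ℝ) (a : ℕ) :
    ∑ u ∈ Finset.Icc 1 a, ((a + 1 - u : ℕ) : ℝ) ^ (-α) =
      ∑ u ∈ Finset.Icc 1 a, (u : ℝ) ^ (-α) := by
  refine Finset.sum_nbij' (fun u => a + 1 - u) (fun u => a + 1 - u) ?_ ?_ ?_ ?_ ?_ <;>
    · intro u hu
      simp only [Finset.mem_Icc] at hu ⊢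
      try omega

/-- A weighted sum over a family of tuples in which the coordinate `j` is determined by the
others gains the factor `η` over the product of the one-dimensional bounds. -/
lemma sum_prod_le_of_determined {ζ κ : Type*} [Fintype κ] [DecidableEq κ]
    (Z : Finset ζ) (φ : ζ → κ → ℕ) (A : Finset ℕ) (w : κ → ℕ → ℝ) (B : κ → ℝ) (η : ℝ) (j : κ)
    (hw : ∀ i u, 0 ≤ w i u) (hB : ∀ i, ∑ u ∈ A, w i u ≤ B i)
    (hj : ∀ u ∈ A, w j u ≤ η * B j) (hη : 0 ≤ η * B j)
    (hA : ∀ z ∈ Z, ∀ i, φ z i ∈ A)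
    (hinj : ∀ z ∈ Z, ∀ z' ∈ Z, (∀ i, i ≠ j → φ z i = φ z' i) → z = z') :
    ∑ z ∈ Z, ∏ i, w i (φ z i) ≤ η * ∏ i, B i := by
  classical
  set w' : κ → ℕ → ℝ := Function.update w j (fun _ => η * B j) with hw'
  have hw'0 : ∀ i u, 0 ≤ w' i u := by
    intro i u
    by_cases h : i = j
    · subst h
      simpa [hw'] using hη
    · simpa [hw', h] using hw i u
  calc ∑ z ∈ Z, ∏ i, w i (φ z i)
      ≤ ∑ z ∈ Z, ∏ i, w' i (Function.update (φ z) j 0 i) := by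
        refine Finset.sum_le_sum fun z hz => Finset.prod_le_prod (fun i _ => hw _ _) ?_
        intro i _
        by_cases h : i = j
        · subst h
          simpa [hw'] using hj _ (hA z hz i)
        · simp [hw', h]
    _ = ∑ p ∈ Z.image (fun z => Function.update (φ z) j 0), ∏ i, w' i (p i) := by
        rw [Finset.sum_image]
        intro z hz z' hz' h
        refine hinj z hz z' hz' fun i hi => ?_
        simpa [hi] using congrFun h i
    _ ≤ ∑ p ∈ Fintype.piFinset (Function.update (fun _ => A) j {0}), ∏ i, w' i (p i) := by
        refine Finset.sum_le_sum_of_subset_of_nonneg ?_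
          fun p _ _ => Finset.prod_nonneg fun i _ => hw'0 _ _
        intro p hp
        obtain ⟨z, hz, rfl⟩ := Finset.mem_image.1 hp
        rw [Fintype.mem_piFinset]
        intro i
        by_cases h : i = j
        · subst h
          simp
        · simpa [h] using hA z hz i
    _ = ∏ i, ∑ u ∈ Function.update (fun _ => A) j {0} i, w' i u :=
        (Finset.prod_univ_sum _ _).symm
    _ ≤ ∏ i, Function.update B j (η * B j) i := by
        refine Finset.prod_le_prod (fun i _ => Finset.sum_nonneg fun u _ => hw'0 _ _) ?_
        intro i _
        by_cases h : i = j
        · subst h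
          simp [hw']
        · simpa [hw', h] using hB i
    _ = η * ∏ i, B i := by
        rw [Finset.prod_update_of_mem (Finset.mem_univ j), mul_assoc,
          ← Finset.prod_erase_mul _ _ (Finset.mem_univ j), Finset.sdiff_singleton_eq_erase]
        ring

lemma prod_fin_two_mul_add_one {N : Type*} [CommMonoid N] (g : ℕ) (f : Fin (2 * g + 1) → N) :
    ∏ i, f i = f 0 * ∏ t : Fin g, (f ⟨2 * t + 1, by omega⟩ * f ⟨2 * t + 2, by omega⟩) := by
  induction g with
  | zero => simp
  | succ g ih =>
    have e := ih (fun i => f ⟨i, by omega⟩)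
    have e' : ∏ i : Fin (2 * (g + 1)), f i.castSucc =
        (∏ i : Fin (2 * g + 1), f ⟨i, by omega⟩) * f ⟨2 * g + 1, by omega⟩ :=
      Fin.prod_univ_castSucc (n := 2 * g + 1) fun i => f i.castSucc
    rw [Fin.prod_univ_castSucc (n := g), Fin.prod_univ_castSucc (n := 2 * (g + 1)), e', e]
    simp only [mul_assoc]
    rfl

/-- Systems `a + z 0 = z 1 + z 2 = ⋯` satisfying a linear equation `∑ i ∈ I, z i = c` are
determined by all but one of the parameters `z 0, z 1, z 3, …`. -/
lemma exists_determined_coordinate {g a c : ℕ} {I : Finset (Fin (2 * g + 1))}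
    (hI : I.Nonempty) :
    ∃ j : Fin (g + 1), ∀ z z' : Fin (2 * g + 1) → ℕ,
      (∀ t : Fin g, a + z 0 = z ⟨2 * t + 1, by omega⟩ + z ⟨2 * t + 2, by omega⟩) →
      (∀ t : Fin g, a + z' 0 = z' ⟨2 * t + 1, by omega⟩ + z' ⟨2 * t + 2, by omega⟩) →
      ∑ i ∈ I, z i = c → ∑ i ∈ I, z' i = c →
      (∀ i, i ≠ j → (Fin.cases (z 0) (fun t : Fin g => z ⟨2 * t + 1, by omega⟩) i : ℕ) =
        (Fin.cases (z' 0) (fun t : Fin g => z' ⟨2 * t + 1, by omega⟩) i : ℕ)) → z = z' := by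
  have index : ∀ i : Fin (2 * g + 1), i = 0 ∨ (∃ t : Fin g, i = ⟨2 * t + 1, by omega⟩) ∨
      ∃ t : Fin g, i = ⟨2 * t + 2, by omega⟩ := by
    intro i
    rcases Nat.even_or_odd' (i : ℕ) with ⟨k, hk | hk⟩
    · rcases Nat.eq_zero_or_pos k with rfl | hk0
      · left
        ext
        simpa using hk
      · right; right
        refine ⟨⟨k - 1, by omega⟩, ?_⟩
        ext
        simp only
        omega
    · right; left
      refine ⟨⟨k, by omega⟩, ?_⟩
      ext
      exact hk
  by_cases hsplit : ∀ t : Fin g, (⟨2 * t + 1, by omega⟩ : Fin (2 * g + 1)) ∈ I ↔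
      (⟨2 * t + 2, by omega⟩ : Fin (2 * g + 1)) ∈ I
  · refine ⟨0, ?_⟩
    have key : ∀ z z' : Fin (2 * g + 1) → ℕ,
        (∀ t : Fin g, a + z 0 = z ⟨2 * t + 1, by omega⟩ + z ⟨2 * t + 2, by omega⟩) →
        (∀ t : Fin g, a + z' 0 = z' ⟨2 * t + 1, by omega⟩ + z' ⟨2 * t + 2, by omega⟩) →
        ∑ i ∈ I, z i = c → ∑ i ∈ I, z' i = c →
        (∀ t : Fin g, z ⟨2 * t + 1, by omega⟩ = z' ⟨2 * t + 1, by omega⟩) →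
        ¬ z 0 < z' 0 := by
      intro z z' hz hz' hc hc' hu hlt
      have hle : ∀ i ∈ I, z i ≤ z' i := by
        intro i _
        rcases index i with rfl | ⟨t, rfl⟩ | ⟨t, rfl⟩
        · exact hlt.le
        · exact (hu t).le
        · have := hz t
          have := hz' t
          have := hu t
          omega
      have heq := (Finset.sum_eq_sum_iff_of_le hle).1 (hc.trans hc'.symm)
      have last : ∀ t : Fin g, (⟨2 * t + 2, by omega⟩ : Fin (2 * g + 1)) ∉ I := by
        intro t ht
        have := heq _ ht
        have := hz t
        have := hz' t
        have := hu t
        omega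
      obtain ⟨i, hi⟩ := hI
      rcases index i with rfl | ⟨t, rfl⟩ | ⟨t, rfl⟩
      · exact hlt.ne (heq _ hi)
      · exact last t ((hsplit t).1 hi)
      · exact last t hi
    intro z z' hz hz' hc hc' h
    have hu : ∀ t : Fin g, z ⟨2 * t + 1, by omega⟩ = z' ⟨2 * t + 1, by omega⟩ :=
      fun t => h t.succ (Fin.succ_ne_zero t)
    have h1 := key z z' hz hz' hc hc' hu
    have h2 := key z' z hz' hz hc' hc fun t => (hu t).symm
    have h0 : z 0 = z' 0 := by omega
    funext i
    rcases index i with rfl | ⟨t, rfl⟩ | ⟨t, rfl⟩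
    · exact h0
    · exact hu t
    · have := hz t
      have := hz' t
      have := hu t
      omega
  · rw [not_forall] at hsplit
    obtain ⟨t₀, ht₀⟩ := hsplit
    refine ⟨t₀.succ, ?_⟩
    intro z z' hz hz' hc hc' h
    have h0 : z 0 = z' 0 := h 0 (Fin.succ_ne_zero t₀).symm
    have hu : ∀ t : Fin g, t ≠ t₀ → z ⟨2 * t + 1, by omega⟩ = z' ⟨2 * t + 1, by omega⟩ :=
      fun t ht => h t.succ fun e => ht (Fin.succ_injective _ e)
    have hother : ∀ i : Fin (2 * g + 1), i ≠ ⟨2 * t₀ + 1, by omega⟩ →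
        i ≠ ⟨2 * t₀ + 2, by omega⟩ → z i = z' i := by
      intro i h1 h2
      rcases index i with rfl | ⟨t, rfl⟩ | ⟨t, rfl⟩
      · exact h0
      · exact hu t fun e => h1 (by rw [e])
      · have := hz t
        have := hz' t
        have := hu t fun e => h2 (by rw [e])
        omega
    have hsum := hc.trans hc'.symm
    have single : ∀ i₀ ∈ I, (∀ i ∈ I, i ≠ i₀ → z i = z' i) → z i₀ = z' i₀ := by
      intro i₀ hi₀ hne
      rw [← Finset.add_sum_erase _ _ hi₀, ← Finset.add_sum_erase _ z' hi₀,
        Finset.sum_congr rfl fun i hi =>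
          hne i (Finset.mem_of_mem_erase hi) (Finset.ne_of_mem_erase hi)] at hsum
      exact Nat.add_right_cancel hsum
    have e1 := hz t₀
    have e2 := hz' t₀
    have hz₀ : z ⟨2 * t₀ + 1, by omega⟩ = z' ⟨2 * t₀ + 1, by omega⟩ := by
      by_cases hm : (⟨2 * t₀ + 1, by omega⟩ : Fin (2 * g + 1)) ∈ I
      · have hm' : (⟨2 * t₀ + 2, by omega⟩ : Fin (2 * g + 1)) ∉ I := fun h' =>
          ht₀ ⟨fun _ => h', fun _ => hm⟩
        exact single _ hm fun i hi hne => hother i hne fun e => hm' (e ▸ hi)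
      · have hm' : (⟨2 * t₀ + 2, by omega⟩ : Fin (2 * g + 1)) ∈ I := by
          by_contra h'
          exact ht₀ ⟨fun h => absurd h hm, fun h => absurd h h'⟩
        have := single _ hm' fun i hi hne => hother i (fun e => hm (e ▸ hi)) hne
        omega
    funext i
    rcases index i with rfl | ⟨t, rfl⟩ | ⟨t, rfl⟩
    · exact h0
    · by_cases ht : t = t₀
      · subst ht
        exact hz₀
      · exact hu t ht
    · have := hz t
      have := hz' t
      by_cases ht : t = t₀
      · subst ht
        omega
      · have := hu t ht
        omega

/-- The constant in the bound for constrained equal-pair-sum systems. -/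
def pairSumConst (g : ℕ) : ℝ :=
  1 / (1 - alph g) * (2 * (1 / (1 - alph g)) * 2 ^ alph g) ^ g

lemma pairSumConst_pos {g : ℕ} (hg : 0 < g) : 0 < pairSumConst g := by
  have := alph_lt_one hg
  have : 0 < 1 - alph g := by linarith
  unfold pairSumConst
  positivity

lemma rpow_neg_mul_rpow_neg_le {α : ℝ} (h0 : 0 < α) {a b u v : ℕ} (hb : 1 ≤ b)
    (hu : 1 ≤ u) (hv : 1 ≤ v) (hua : u ≤ a) (h : a + b = u + v) :
    (u : ℝ) ^ (-α) * (v : ℝ) ^ (-α) ≤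
      ((a : ℝ) / 2) ^ (-α) * ((u : ℝ) ^ (-α) + ((a + 1 - u : ℕ) : ℝ) ^ (-α)) := by
  have ha : (0 : ℝ) < (a : ℝ) / 2 := by
    have : (0 : ℝ) < a := by exact_mod_cast (by omega : 0 < a)
    positivity
  have hu' : (0 : ℝ) < u := by exact_mod_cast hu
  have hv' : (0 : ℝ) < v := by exact_mod_cast hv
  have hd : (0 : ℝ) < ((a + 1 - u : ℕ) : ℝ) := by exact_mod_cast (by omega : 0 < a + 1 - u)
  have hR : (a : ℝ) + b = u + v := by exact_mod_cast h
  have hb' : (1 : ℝ) ≤ b := by exact_mod_cast hb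
  rw [mul_add]
  rcases le_total ((a : ℝ) / 2) u with hc | hc
  · have h1 : (u : ℝ) ^ (-α) ≤ ((a : ℝ) / 2) ^ (-α) :=
      Real.rpow_le_rpow_of_nonpos ha hc (by linarith)
    have h2 : (v : ℝ) ^ (-α) ≤ ((a + 1 - u : ℕ) : ℝ) ^ (-α) :=
      Real.rpow_le_rpow_of_nonpos hd (by exact_mod_cast (by omega : a + 1 - u ≤ v))
        (by linarith)
    have h3 : (u : ℝ) ^ (-α) * (v : ℝ) ^ (-α) ≤
        ((a : ℝ) / 2) ^ (-α) * ((a + 1 - u : ℕ) : ℝ) ^ (-α) := by gcongr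
    have : 0 ≤ ((a : ℝ) / 2) ^ (-α) * (u : ℝ) ^ (-α) := by positivity
    linarith
  · have h1 : (v : ℝ) ^ (-α) ≤ ((a : ℝ) / 2) ^ (-α) :=
      Real.rpow_le_rpow_of_nonpos ha (by linarith) (by linarith)
    have h3 : (u : ℝ) ^ (-α) * (v : ℝ) ^ (-α) ≤ ((a : ℝ) / 2) ^ (-α) * (u : ℝ) ^ (-α) := by
      rw [mul_comm]
      gcongr
    have : 0 ≤ ((a : ℝ) / 2) ^ (-α) * ((a + 1 - u : ℕ) : ℝ) ^ (-α) := by positivity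
    linarith

/-- Weighted count of the solutions of `a + z 0 = z 1 + z 2 = ⋯` with one extra linear
equation. -/
lemma sum_constrained_pairs_le {g a c : ℕ} (hg : 0 < g) (ha : 1 ≤ a)
    {I : Finset (Fin (2 * g + 1))} (hI : I.Nonempty) (Z : Finset (Fin (2 * g + 1) → ℕ))
    (hpos : ∀ z ∈ Z, ∀ i, 1 ≤ z i) (hle : ∀ z ∈ Z, ∀ i, z i ≤ a)
    (hsys : ∀ z ∈ Z, ∀ t : Fin g,
      a + z 0 = z ⟨2 * t + 1, by omega⟩ + z ⟨2 * t + 2, by omega⟩)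
    (hc : ∀ z ∈ Z, ∑ i ∈ I, z i = c) :
    ∑ z ∈ Z, ∏ i, (z i : ℝ) ^ (-alph g) ≤ pairSumConst g * (a : ℝ) ^ (-(1 - alph g)) := by
  set α := alph g with hα
  have h0 : 0 < α := alph_pos g
  have h1 : α < 1 := alph_lt_one hg
  have h1' : 0 < 1 - α := by linarith
  have haR : (0 : ℝ) < a := by exact_mod_cast ha
  set D := 1 / (1 - α) with hD
  have hD1 : 1 ≤ D := by
    rw [hD, le_div_iff₀ h1']
    linarith
  set h : ℕ → ℝ := fun u => ((a : ℝ) / 2) ^ (-α) *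
    ((u : ℝ) ^ (-α) + ((a + 1 - u : ℕ) : ℝ) ^ (-α)) with hh
  set w : Fin (g + 1) → ℕ → ℝ := Fin.cases (fun u => (u : ℝ) ^ (-α)) (fun _ => h) with hw
  set B : Fin (g + 1) → ℝ := Fin.cases (D * (a : ℝ) ^ (1 - α))
    (fun _ => ((a : ℝ) / 2) ^ (-α) * (2 * (D * (a : ℝ) ^ (1 - α)))) with hB
  obtain ⟨j, hj⟩ := exists_determined_coordinate (a := a) (c := c) hI
  have hsum : ∑ u ∈ Finset.Icc 1 a, (u : ℝ) ^ (-α) ≤ D * (a : ℝ) ^ (1 - α) :=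
    sum_Icc_rpow_neg_le h0 h1 a
  have hη : (a : ℝ) ^ (-(1 - α)) * (D * (a : ℝ) ^ (1 - α)) = D := by
    rw [mul_left_comm, ← Real.rpow_add haR]
    simp
  have hone : ∀ u : ℕ, 1 ≤ u → (u : ℝ) ^ (-α) ≤ 1 := fun u hu =>
    Real.rpow_le_one_of_one_le_of_nonpos (by exact_mod_cast hu) (by linarith)
  have main := sum_prod_le_of_determined Z
    (fun z => Fin.cases (z 0) (fun t : Fin g => z ⟨2 * t + 1, by omega⟩))
    (Finset.Icc 1 a) w B ((a : ℝ) ^ (-(1 - α))) j ?_ ?_ ?_ ?_ ?_ ?_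
  · refine (Finset.sum_le_sum fun z hz => ?_).trans (main.trans_eq ?_)
    · rw [prod_fin_two_mul_add_one, Fin.prod_univ_succ]
      simp only [hw, Fin.cases_zero, Fin.cases_succ]
      gcongr with t
      exact rpow_neg_mul_rpow_neg_le h0 (hpos z hz 0) (hpos z hz _) (hpos z hz _)
        (hle z hz _) (hsys z hz t)
    · rw [Fin.prod_univ_succ]
      simp only [hB, Fin.cases_zero, Fin.cases_succ, Finset.prod_const, Finset.card_univ,
        Fintype.card_fin]
      have e1 : ((a : ℝ) / 2) ^ (-α) * (2 * (D * (a : ℝ) ^ (1 - α))) =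
          (2 * D * 2 ^ α) * (a : ℝ) ^ (1 - 2 * α) := by
        rw [Real.div_rpow haR.le (by norm_num), Real.rpow_neg (by norm_num : (0 : ℝ) ≤ 2),
          show 1 - 2 * α = -α + (1 - α) by ring, Real.rpow_add haR]
        field_simp
      rw [e1, mul_pow, ← Real.rpow_natCast ((a : ℝ) ^ (1 - 2 * α)), ← Real.rpow_mul haR.le]
      have e2 : (1 - 2 * α) * g = -(1 - α) := by
        rw [hα, alph]
        field_simp
        ring
      rw [e2, pairSumConst, ← hα, ← hD]
      have e3 : (a : ℝ) ^ (1 - α) * (a : ℝ) ^ (-(1 - α)) = 1 := by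
        rw [← Real.rpow_add haR]
        simp
      linear_combination (a : ℝ) ^ (-(1 - α)) * D * (2 * D * 2 ^ α) ^ g * e3
  · intro i u
    refine Fin.cases ?_ (fun t => ?_) i
    · simp only [hw, Fin.cases_zero]
      positivity
    · simp only [hw, Fin.cases_succ, hh]
      positivity
  · intro i
    refine Fin.cases ?_ (fun t => ?_) i
    · simpa only [hw, hB, Fin.cases_zero] using hsum
    · simp only [hw, hB, Fin.cases_succ, hh]
      rw [← Finset.mul_sum, Finset.sum_add_distrib, sum_Icc_rpow_neg_reflect]
      gcongr
      linarith
  · intro u hu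
    rw [Finset.mem_Icc] at hu
    refine Fin.cases ?_ (fun t => ?_) j
    · simp only [hw, hB, Fin.cases_zero]
      rw [hη]
      exact (hone u hu.1).trans hD1
    · simp only [hw, hB, Fin.cases_succ, hh]
      rw [mul_left_comm, mul_left_comm _ 2, hη]
      gcongr
      have := hone u hu.1
      have := hone (a + 1 - u) (by omega)
      linarith
  · refine Fin.cases ?_ (fun t => ?_) j
    · simp only [hB, Fin.cases_zero]
      positivity
    · simp only [hB, Fin.cases_succ]
      positivity
  · intro z hz i
    rw [Finset.mem_Icc]
    refine Fin.cases ?_ (fun t => ?_) i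
    · exact ⟨hpos z hz _, hle z hz _⟩
    · exact ⟨hpos z hz _, hle z hz _⟩
  · intro z hz z' hz' hzz
    exact hj z z' (hsys z hz) (hsys z' hz') (hc z hz) (hc z' hz') hzz

/-- The coordinates of a tuple after the first three. -/
def tailFun (g : ℕ) (x : Fin (2 * g + 4) → ℕ) (i : Fin (2 * g + 1)) : ℕ :=
  x ⟨(i : ℕ) + 3, by have := i.isLt; omega⟩

lemma prod_fin_head_tail (g : ℕ) (f : Fin (2 * g + 4) → ℝ) :
    ∏ i, f i = f ⟨0, by omega⟩ * f ⟨1, by omega⟩ * f ⟨2, by omega⟩ *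
      ∏ i : Fin (2 * g + 1), f ⟨(i : ℕ) + 3, by have := i.isLt; omega⟩ := by
  rw [Fin.prod_univ_succ, Fin.prod_univ_succ, Fin.prod_univ_succ, mul_assoc, mul_assoc]
  rfl

/-- Triples of sum `n` whose first entry is comparable to `G` and whose others are large. -/
def SmallFirst (G : ℝ) (n y₁ y₂ y₃ : ℕ) : Prop :=
  0 < y₁ ∧ 0 < y₂ ∧ 0 < y₃ ∧ y₁ + y₂ + y₃ = n ∧ G / 2 ≤ (y₁ : ℝ) ∧ (y₁ : ℝ) ≤ G ∧
    (n : ℝ) / 4 ≤ (y₂ : ℝ) ∧ (n : ℝ) / 4 ≤ (y₃ : ℝ)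

lemma TnInd.smallFirst {g M : ℕ} {lam : ℝ} {s : ℕ → Fin 3 → ZMod M} {n : ℕ}
    {x : Fin (2 * g + 4) → ℕ} (hx : x ∈ TnInd g M lam s n) :
    SmallFirst (glam g lam n) n (x ⟨0, by omega⟩) (x ⟨1, by omega⟩) (x ⟨2, by omega⟩) ∨
    SmallFirst (glam g lam n) n (x ⟨1, by omega⟩) (x ⟨0, by omega⟩) (x ⟨2, by omega⟩) ∨
    SmallFirst (glam g lam n) n (x ⟨2, by omega⟩) (x ⟨0, by omega⟩) (x ⟨1, by omega⟩) := by
  obtain ⟨⟨-, ⟨y₁, y₂, y₃, he, hy⟩, -⟩, hinj⟩ := hx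
  have h01 : x ⟨0, by omega⟩ ≠ x ⟨1, by omega⟩ := fun h => by simpa using hinj h
  have h02 : x ⟨0, by omega⟩ ≠ x ⟨2, by omega⟩ := fun h => by simpa using hinj h
  have h12 : x ⟨1, by omega⟩ ≠ x ⟨2, by omega⟩ := fun h => by simpa using hinj h
  unfold firstThree at he
  generalize x ⟨0, by omega⟩ = a at *
  generalize x ⟨1, by omega⟩ = b at *
  generalize x ⟨2, by omega⟩ = c at *
  obtain ⟨p1, p2, p3, hs, l1, l2, l3, -, l4, -, -⟩ := hy
  have ha : a ∈ ({y₁, y₂, y₃} : Finset ℕ) := he ▸ by simp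
  have hb : b ∈ ({y₁, y₂, y₃} : Finset ℕ) := he ▸ by simp
  have hc : c ∈ ({y₁, y₂, y₃} : Finset ℕ) := he ▸ by simp
  simp only [Finset.mem_insert, Finset.mem_singleton] at ha hb hc
  unfold SmallFirst
  rcases ha with rfl | rfl | rfl <;> rcases hb with rfl | rfl | rfl <;>
    rcases hc with rfl | rfl | rfl <;> first
    | exact absurd rfl h01
    | exact absurd rfl h02
    | exact absurd rfl h12
    | exact Or.inl ⟨by omega, by omega, by omega, by omega, l1, l2, by assumption, by assumption⟩
    | exact Or.inr (Or.inl
        ⟨by omega, by omega, by omega, by omega, l1, l2, by assumption, by assumption⟩)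
    | exact Or.inr (Or.inr
        ⟨by omega, by omega, by omega, by omega, l1, l2, by assumption, by assumption⟩)

lemma SmallFirst.bounds {G : ℝ} {n y₁ y₂ y₃ : ℕ} (h : SmallFirst G n y₁ y₂ y₃) :
    1 ≤ G ∧ 1 ≤ n ∧ G / 8 ≤ y₁ ∧ G / 8 ≤ y₂ ∧ G / 8 ≤ y₃ := by
  obtain ⟨p1, p2, p3, hs, l1, l2, l3, l4⟩ := h
  have hsR : (y₁ : ℝ) + y₂ + y₃ = n := by exact_mod_cast hs
  have q1 : (1 : ℝ) ≤ y₁ := by exact_mod_cast p1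
  have q2 : (1 : ℝ) ≤ y₂ := by exact_mod_cast p2
  have q3 : (1 : ℝ) ≤ y₃ := by exact_mod_cast p3
  exact ⟨by linarith, by omega, by linarith, by linarith, by linarith⟩

lemma SmallFirst.weight_le {G α : ℝ} (hα : 0 < α) {n y₁ y₂ y₃ : ℕ}
    (h : SmallFirst G n y₁ y₂ y₃) :
    (y₁ : ℝ) ^ (-α) * (y₂ : ℝ) ^ (-α) * (y₃ : ℝ) ^ (-α) ≤
      (G / 8) ^ (-α) * ((n : ℝ) / 4) ^ (-α) * ((n : ℝ) / 4) ^ (-α) := by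
  obtain ⟨hG, hn, b1, -, -⟩ := h.bounds
  obtain ⟨-, -, -, -, -, -, l3, l4⟩ := h
  have hn' : (0 : ℝ) < (n : ℝ) / 4 := by
    have : (0 : ℝ) < n := by exact_mod_cast hn
    positivity
  have e1 := Real.rpow_le_rpow_of_nonpos (by linarith) b1 (by linarith : -α ≤ 0)
  have e2 := Real.rpow_le_rpow_of_nonpos hn' l3 (by linarith : -α ≤ 0)
  have e3 := Real.rpow_le_rpow_of_nonpos hn' l4 (by linarith : -α ≤ 0)
  have : 0 < (G / 8) ^ (-α) := Real.rpow_pos_of_pos (by linarith) _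
  gcongr

lemma Rn.sum_eq {g M : ℕ} {lam : ℝ} {CM : Set (ZMod M)} {s : ℕ → Fin 3 → ZMod M}
    (hs : GoodS M CM s) {n : ℕ} {w : Finset ℕ} (hw : w ∈ Rn g M lam s n) :
    ∑ a ∈ w, a = n := by
  obtain ⟨y₁, y₂, y₃, rfl, -, -, -, hsum, -, -, -, -, -, -, c1, c2, c3⟩ := hw
  obtain ⟨-, h01, h02, h12, -⟩ := hs n
  have h1 : y₁ ≠ y₂ := fun h => h01 (by rw [← c1, ← c2, h])
  have h2 : y₁ ≠ y₃ := fun h => h02 (by rw [← c1, ← c3, h])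
  have h3 : y₂ ≠ y₃ := fun h => h12 (by rw [← c2, ← c3, h])
  rw [Finset.sum_insert (by simp [h1, h2]), Finset.sum_insert (by simp [h3]),
    Finset.sum_singleton]
  omega

lemma ncard_CcalR_le {g M m : ℕ} {lam : ℝ} {CM : Set (ZMod M)} {s : ℕ → Fin 3 → ZMod M}
    (hs : GoodS M CM s) {n : ℕ} (z : Fin m → ℕ) (hz : Function.Injective z)
    (r f : Finset ℕ) :
    Set.ncard {w ∈ CcalR g M lam s n (Finset.univ.image z) r | w ∩ f = ∅} ≤
      ((((Finset.univ : Finset (Finset (Fin m))).filter Finset.Nonempty) ×ˢ r.powerset).filter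
        (fun p => ∑ i ∈ p.1, z i + ∑ a ∈ p.2, a = n)).card := by
  classical
  refine le_trans (Set.ncard_le_ncard (t := ((Finset.image
    (fun p : Finset (Fin m) × Finset ℕ => p.1.image z ∪ p.2) _ : Finset (Finset ℕ)) :
      Set (Finset ℕ))) ?_ (Finset.finite_toSet _))
    ((Set.ncard_coe_finset _).trans_le Finset.card_image_le)
  rintro w ⟨⟨hw, hsub, b, hbw, hbX, hbr⟩, -⟩
  have hunion : (Finset.univ.filter fun i => z i ∈ w ∧ z i ∉ r).image z ∪ (w ∩ r) = w := by
    ext a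
    simp only [Finset.mem_union, Finset.mem_image, Finset.mem_filter, Finset.mem_univ,
      true_and, Finset.mem_inter]
    constructor
    · rintro (⟨i, ⟨h1, -⟩, rfl⟩ | h)
      · exact h1
      · exact h.1
    · intro ha
      by_cases har : a ∈ r
      · exact Or.inr ⟨ha, har⟩
      · left
        rcases Finset.mem_union.1 (hsub ha) with h | h
        · obtain ⟨i, -, rfl⟩ := Finset.mem_image.1 h
          exact ⟨i, ⟨ha, har⟩, rfl⟩
        · exact absurd h har
  have hdisj : Disjoint ((Finset.univ.filter fun i => z i ∈ w ∧ z i ∉ r).image z) (w ∩ r) := by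
    rw [Finset.disjoint_left]
    intro a ha har
    obtain ⟨i, hi, rfl⟩ := Finset.mem_image.1 ha
    exact (Finset.mem_filter.1 hi).2.2 (Finset.mem_inter.1 har).2
  rw [Finset.mem_coe, Finset.mem_image]
  refine ⟨(Finset.univ.filter fun i => z i ∈ w ∧ z i ∉ r, w ∩ r), ?_, hunion⟩
  rw [Finset.mem_filter, Finset.mem_product, Finset.mem_filter, Finset.mem_powerset]
  refine ⟨⟨⟨Finset.mem_univ _, ?_⟩, Finset.inter_subset_right⟩, ?_⟩
  · obtain ⟨i, -, rfl⟩ := Finset.mem_image.1 hbX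
    exact ⟨i, Finset.mem_filter.2 ⟨Finset.mem_univ _, hbw, hbr⟩⟩
  · have h := Rn.sum_eq hs hw
    rw [← hunion, Finset.sum_union hdisj, Finset.sum_image hz.injOn] at h
    exact h

/-- The possible values of the first three coordinates. -/
def headTriples (G : ℝ) (n : ℕ) : Finset (ℕ × ℕ × ℕ) :=
  ((Finset.Icc 1 ⌊G⌋₊ ×ˢ Finset.Icc 1 n).image fun p => (p.1, p.2, n - p.1 - p.2)) ∪
  (((Finset.Icc 1 ⌊G⌋₊ ×ˢ Finset.Icc 1 n).image fun p => (p.2, p.1, n - p.1 - p.2)) ∪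
  ((Finset.Icc 1 ⌊G⌋₊ ×ˢ Finset.Icc 1 n).image fun p => (p.2, n - p.1 - p.2, p.1)))

lemma card_headTriples_le {G : ℝ} (hG : 0 ≤ G) (n : ℕ) :
    ((headTriples G n).card : ℝ) ≤ 3 * (G * n) := by
  have hP : (Finset.Icc 1 ⌊G⌋₊ ×ˢ Finset.Icc 1 n).card = ⌊G⌋₊ * n := by
    rw [Finset.card_product, Nat.card_Icc, Nat.card_Icc]
    simp
  have h : (headTriples G n).card ≤ 3 * (⌊G⌋₊ * n) := by
    unfold headTriples
    refine (Finset.card_union_le _ _).trans ?_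
    refine (add_le_add Finset.card_image_le ((Finset.card_union_le _ _).trans
      (add_le_add Finset.card_image_le Finset.card_image_le))).trans ?_
    rw [hP]
    omega
  calc ((headTriples G n).card : ℝ) ≤ ((3 * (⌊G⌋₊ * n) : ℕ) : ℝ) := by exact_mod_cast h
    _ = 3 * ((⌊G⌋₊ : ℝ) * n) := by push_cast; ring
    _ ≤ 3 * (G * n) := by
      gcongr
      exact Nat.floor_le hG

lemma SmallFirst.mem_product {G : ℝ} {n y₁ y₂ y₃ : ℕ} (h : SmallFirst G n y₁ y₂ y₃) :
    (y₁, y₂) ∈ Finset.Icc 1 ⌊G⌋₊ ×ˢ Finset.Icc 1 n ∧ n - y₁ - y₂ = y₃ := by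
  obtain ⟨p1, p2, p3, hs, l1, l2, l3, l4⟩ := h
  simp only [Finset.mem_product, Finset.mem_Icc]
  exact ⟨⟨⟨p1, Nat.le_floor l2⟩, p2, by omega⟩, by omega⟩

lemma TnInd.head_mem {g M : ℕ} {lam : ℝ} {s : ℕ → Fin 3 → ZMod M} {n : ℕ}
    {x : Fin (2 * g + 4) → ℕ} (hx : x ∈ TnInd g M lam s n) :
    (x ⟨0, by omega⟩, x ⟨1, by omega⟩, x ⟨2, by omega⟩) ∈ headTriples (glam g lam n) n := by
  simp only [headTriples, Finset.mem_union, Finset.mem_image]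
  rcases TnInd.smallFirst hx with h | h | h
  · exact Or.inl ⟨_, h.mem_product.1, by simp only [h.mem_product.2]⟩
  · exact Or.inr (Or.inl ⟨_, h.mem_product.1, by simp only [h.mem_product.2]⟩)
  · exact Or.inr (Or.inr ⟨_, h.mem_product.1, by simp only [h.mem_product.2]⟩)

lemma TnInd.head_bounds {g M : ℕ} {lam : ℝ} {s : ℕ → Fin 3 → ZMod M} {n : ℕ}
    {x : Fin (2 * g + 4) → ℕ} (hx : x ∈ TnInd g M lam s n) :
    1 ≤ glam g lam n ∧ 1 ≤ n ∧ glam g lam n / 8 ≤ x ⟨0, by omega⟩ ∧ x ⟨0, by omega⟩ ≤ n := by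
  rcases TnInd.smallFirst hx with h | h | h <;>
    have hb := h.bounds <;> have hs := h.2.2.2.1
  · exact ⟨hb.1, hb.2.1, hb.2.2.1, by omega⟩
  · exact ⟨hb.1, hb.2.1, hb.2.2.2.1, by omega⟩
  · exact ⟨hb.1, hb.2.1, hb.2.2.2.1, by omega⟩

lemma TnInd.head_weight_le {g M : ℕ} {lam : ℝ} {s : ℕ → Fin 3 → ZMod M} {n : ℕ}
    {x : Fin (2 * g + 4) → ℕ} (hx : x ∈ TnInd g M lam s n) :
    (x ⟨0, by omega⟩ : ℝ) ^ (-alph g) * (x ⟨1, by omega⟩ : ℝ) ^ (-alph g) *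
        (x ⟨2, by omega⟩ : ℝ) ^ (-alph g) ≤
      (glam g lam n / 8) ^ (-alph g) * ((n : ℝ) / 4) ^ (-alph g) *
        ((n : ℝ) / 4) ^ (-alph g) := by
  rcases TnInd.smallFirst hx with h | h | h <;>
    refine le_trans (le_of_eq ?_) (h.weight_le (alph_pos g)) <;> ring

lemma TnInd.tail_sum_eq {g M : ℕ} {lam : ℝ} {s : ℕ → Fin 3 → ZMod M} {n : ℕ}
    {x : Fin (2 * g + 4) → ℕ} (hx : x ∈ TnInd g M lam s n) (t : Fin g) :
    x ⟨0, by omega⟩ + tailFun g x 0 =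
      tailFun g x ⟨2 * t + 1, by omega⟩ + tailFun g x ⟨2 * t + 2, by omega⟩ := by
  have h := hx.1.2.2.1 (t + 2) (by omega) (by omega)
  have e1 : (⟨2 * ((t : ℕ) + 2), by omega⟩ : Fin (2 * g + 4)) = ⟨2 * t + 1 + 3, by omega⟩ :=
    Fin.ext (by simp only; ring)
  have e2 : (⟨2 * ((t : ℕ) + 2) + 1, by omega⟩ : Fin (2 * g + 4)) =
      ⟨2 * t + 2 + 3, by omega⟩ := Fin.ext (by simp only; ring)
  rw [e1, e2] at h
  exact h

lemma TnInd.finite (g M : ℕ) (lam : ℝ) (s : ℕ → Fin 3 → ZMod M) (n : ℕ) :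
    (TnInd g M lam s n).Finite := by
  refine (Set.Finite.pi' fun _ : Fin (2 * g + 4) => Set.finite_Iic n).subset ?_
  intro x hx i
  have h0 := (TnInd.head_bounds hx).2.2.2
  rw [Set.mem_Iic]
  rcases lt_or_ge (i : ℕ) 3 with hi | hi
  · have hsum : x ⟨0, by omega⟩ + x ⟨1, by omega⟩ + x ⟨2, by omega⟩ = n := by
      rcases TnInd.smallFirst hx with h | h | h <;> have := h.2.2.2.1 <;> omega
    obtain ⟨i, hi'⟩ := i
    simp only at hi
    interval_cases i <;> omega
  · exact (hx.1.2.2.2.1 i hi).trans h0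

/-- Weighted count of the elements of `TnInd` satisfying one linear equation in the tail. -/
lemma sum_TnInd_constrained_le {g M n c : ℕ} (hg : 0 < g) {lam : ℝ}
    {s : ℕ → Fin 3 → ZMod M} {I : Finset (Fin (2 * g + 1))} (hI : I.Nonempty)
    (F : Finset (Fin (2 * g + 4) → ℕ)) (hF : ∀ x ∈ F, x ∈ TnInd g M lam s n)
    (hc : ∀ x ∈ F, ∑ i ∈ I, tailFun g x i = c) :
    ∑ x ∈ F, ∏ i, (x i : ℝ) ^ (-alph g) ≤
      24 * pairSumConst g * 4 ^ (2 * alph g) * (n : ℝ) ^ (-(2 * alph g - 1)) := by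
  classical
  have hK := pairSumConst_pos hg
  have h1 := alph_lt_one hg
  rcases F.eq_empty_or_nonempty with rfl | ⟨x₀, hx₀⟩
  · rw [Finset.sum_empty]
    positivity
  obtain ⟨hG, hn, -⟩ := TnInd.head_bounds (hF x₀ hx₀)
  set G := glam g lam n with hGdef
  set α := alph g with hα
  have hG8 : 0 < G / 8 := by linarith
  have hnR : (0 : ℝ) < n := by exact_mod_cast hn
  set T : (Fin (2 * g + 4) → ℕ) → ℝ := fun x => ∏ i, (tailFun g x i : ℝ) ^ (-α) with hT
  have hT0 : ∀ x, 0 ≤ T x := fun x => Finset.prod_nonneg fun i _ => by positivity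
  set H := (G / 8) ^ (-α) * ((n : ℝ) / 4) ^ (-α) * ((n : ℝ) / 4) ^ (-α) with hH
  have hH0 : 0 ≤ H := by positivity
  set head : (Fin (2 * g + 4) → ℕ) → ℕ × ℕ × ℕ :=
    fun x => (x ⟨0, by omega⟩, x ⟨1, by omega⟩, x ⟨2, by omega⟩) with hhead
  have fiber : ∀ τ ∈ headTriples G n, ∑ x ∈ F with head x = τ, T x ≤
      pairSumConst g * (G / 8) ^ (-(1 - α)) := by
    intro τ _
    rcases (F.filter fun x => head x = τ).eq_empty_or_nonempty with he | ⟨x₁, hx₁⟩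
    · rw [he, Finset.sum_empty]
      positivity
    obtain ⟨hx₁F, rfl⟩ := Finset.mem_filter.1 hx₁
    have hmem : ∀ x ∈ F.filter fun x => head x = head x₁, x ∈ TnInd g M lam s n :=
      fun x hx => hF x (Finset.mem_filter.1 hx).1
    have hhd : ∀ x ∈ F.filter fun x => head x = head x₁, head x = head x₁ :=
      fun x hx => (Finset.mem_filter.1 hx).2
    have hx0 : ∀ x ∈ F.filter fun x => head x = head x₁,
        x ⟨0, by omega⟩ = x₁ ⟨0, by omega⟩ := fun x hx => congrArg Prod.fst (hhd x hx)
    have hinj : Set.InjOn (tailFun g) (F.filter fun x => head x = head x₁) := by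
      intro x hx y hy hxy
      have e := (hhd x hx).trans (hhd y hy).symm
      simp only [hhead, Prod.mk.injEq] at e
      funext i
      rcases lt_or_ge (i : ℕ) 3 with hi | hi
      · obtain ⟨i, hi'⟩ := i
        simp only at hi
        interval_cases i
        · exact e.1
        · exact e.2.1
        · exact e.2.2
      · have := congrFun hxy ⟨i - 3, by omega⟩
        have ei : (⟨(i : ℕ) - 3 + 3, by omega⟩ : Fin (2 * g + 4)) = i :=
          Fin.ext (by simp only; omega)
        simpa only [tailFun, ei] using this
    have hsum := sum_constrained_pairs_le (a := x₁ ⟨0, by omega⟩) (c := c) hg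
      ((hF x₁ hx₁F).1.1 _) hI ((F.filter fun x => head x = head x₁).image (tailFun g))
      ?_ ?_ ?_ ?_
    · rw [Finset.sum_image hinj] at hsum
      refine hsum.trans ?_
      have := Real.rpow_le_rpow_of_nonpos hG8 (TnInd.head_bounds (hF x₁ hx₁F)).2.2.1
        (by linarith : -(1 - α) ≤ 0)
      gcongr
    all_goals
      intro z hz
      obtain ⟨x, hx, rfl⟩ := Finset.mem_image.1 hz
      have hxT := hmem x hx
      have e0 := hx0 x hx
    · exact fun i => hxT.1.1 _
    · exact fun i => e0 ▸ hxT.1.2.2.2.1 _ (by simp)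
    · exact fun t => e0 ▸ TnInd.tail_sum_eq hxT t
    · exact hc x (Finset.mem_filter.1 hx).1
  calc ∑ x ∈ F, ∏ i, (x i : ℝ) ^ (-α)
      ≤ ∑ x ∈ F, H * T x := by
        refine Finset.sum_le_sum fun x hx => ?_
        rw [prod_fin_head_tail]
        exact mul_le_mul_of_nonneg_right (TnInd.head_weight_le (hF x hx)) (hT0 x)
    _ = H * ∑ τ ∈ headTriples G n, ∑ x ∈ F with head x = τ, T x := by
        rw [← Finset.mul_sum, Finset.sum_fiberwise_of_maps_to]
        exact fun x hx => TnInd.head_mem (hF x hx)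
    _ ≤ H * ((3 * (G * n)) * (pairSumConst g * (G / 8) ^ (-(1 - α)))) := by
        gcongr
        refine (Finset.sum_le_card_nsmul _ _ _ fiber).trans ?_
        rw [nsmul_eq_mul]
        gcongr
        exact card_headTriples_le (by linarith) n
    _ = 24 * pairSumConst g * 4 ^ (2 * α) * (n : ℝ) ^ (-(2 * α - 1)) := by
        have e1 : (G / 8) ^ (-α) * (G / 8) ^ (-(1 - α)) * G = 8 := by
          rw [← Real.rpow_add hG8, show -α + -(1 - α) = -1 by ring, Real.rpow_neg_one]
          field_simp
        have e2 : ((n : ℝ) / 4) ^ (-α) * ((n : ℝ) / 4) ^ (-α) * n =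
            4 ^ (2 * α) * (n : ℝ) ^ (-(2 * α - 1)) := by
          rw [← Real.rpow_add (by positivity), show -α + -α = -(2 * α) by ring,
            Real.div_rpow hnR.le (by norm_num), Real.rpow_neg (by norm_num : (0 : ℝ) ≤ 4),
            show -(2 * α - 1) = -(2 * α) + 1 by ring, Real.rpow_add_one hnR.ne']
          field_simp
        calc _ = 3 * pairSumConst g * ((G / 8) ^ (-α) * (G / 8) ^ (-(1 - α)) * G) *
              (((n : ℝ) / 4) ^ (-α) * ((n : ℝ) / 4) ^ (-α) * n) := by
                rw [hH]
                ring
          _ = _ := by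
                rw [e1, e2]
                ring

theorem stmt16 (g M : ℕ) (hg : 2 ≤ g) (hM : 1 ≤ M) (CM : Set (ZMod M))
    (hSidon : IsSidonZ CM) (hcov : Covers3 CM) :
    ∃ δ : ℝ, 0 < δ ∧
      ∀ s : ℕ → Fin 3 → ZMod M, GoodS M CM s →
      ∀ lam : ℝ, 1 < lam → ∃ C : ℝ, 0 < C ∧ ∃ n₀ : ℕ, ∀ n : ℕ, n₀ ≤ n →
      ∀ r : Finset ℕ, (∀ a ∈ r, 1 ≤ a ∧ a ≤ n) → r.card ≤ 2 * g + 4 →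
        (∑' x : ↥(TnInd g M lam s n),
          (∏ i : Fin (2 * g + 4), (x.1 i : ℝ) ^ (-alph g)) *
            (Set.ncard {w ∈ CcalR g M lam s n (tailSet g x.1) r |
              w ∩ firstThree g x.1 = ∅} : ℝ))
        ≤ C * (n : ℝ) ^ (-δ) := by
  classical
  have hg0 : 0 < g := by omega
  have hK := pairSumConst_pos hg0
  refine ⟨2 * alph g - 1, ?_, ?_⟩
  · have : 2 * alph g - 1 = 1 / (2 * (g : ℝ) + 1) := by
      unfold alph
      field_simp
      ring
    rw [this]
    positivity
  intro s hs lam _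
  refine ⟨2 ^ (2 * g + 1) * 2 ^ (2 * g + 4) * (24 * pairSumConst g * 4 ^ (2 * alph g)),
    by positivity, 0, fun n _ r _ hr => ?_⟩
  obtain ⟨F, hF⟩ := (TnInd.finite g M lam s n).exists_finset_coe
  have hFmem : ∀ x ∈ F, x ∈ TnInd g M lam s n := fun x hx => hF ▸ hx
  rw [← hF, Finset.tsum_subtype' F fun x => (∏ i : Fin (2 * g + 4), (x i : ℝ) ^ (-alph g)) *
    (Set.ncard {w ∈ CcalR g M lam s n (tailSet g x) r | w ∩ firstThree g x = ∅} : ℝ)]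
  set P := ((Finset.univ : Finset (Finset (Fin (2 * g + 1)))).filter Finset.Nonempty) ×ˢ
    r.powerset with hP
  have hPcard : (P.card : ℝ) ≤ 2 ^ (2 * g + 1) * 2 ^ (2 * g + 4) := by
    have h1 : P.card ≤ 2 ^ (2 * g + 1) * 2 ^ (2 * g + 4) := by
      rw [hP, Finset.card_product, Finset.card_powerset]
      refine Nat.mul_le_mul ((Finset.card_filter_le _ _).trans_eq ?_)
        (Nat.pow_le_pow_right (by norm_num) hr)
      simp
    exact_mod_cast h1
  calc ∑ x ∈ F, (∏ i : Fin (2 * g + 4), (x i : ℝ) ^ (-alph g)) *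
        (Set.ncard {w ∈ CcalR g M lam s n (tailSet g x) r | w ∩ firstThree g x = ∅} : ℝ)
      ≤ ∑ x ∈ F, ∑ p ∈ P, if ∑ i ∈ p.1, tailFun g x i + ∑ a ∈ p.2, a = n then
          ∏ i : Fin (2 * g + 4), (x i : ℝ) ^ (-alph g) else 0 := by
        refine Finset.sum_le_sum fun x hx => ?_
        have hinj : Function.Injective (tailFun g x) := by
          intro i j hij
          have := (hFmem x hx).2 hij
          rw [Fin.mk.injEq] at this
          exact Fin.ext (by omega)
        have h := ncard_CcalR_le (g := g) (lam := lam) hs (n := n) (tailFun g x) hinj r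
          (firstThree g x)
        rw [← Finset.sum_filter, Finset.sum_const, nsmul_eq_mul, mul_comm]
        exact mul_le_mul_of_nonneg_right (by exact_mod_cast h)
          (Finset.prod_nonneg fun i _ => by positivity)
    _ = ∑ p ∈ P, ∑ x ∈ F with ∑ i ∈ p.1, tailFun g x i + ∑ a ∈ p.2, a = n,
          ∏ i : Fin (2 * g + 4), (x i : ℝ) ^ (-alph g) := by
        rw [Finset.sum_comm]
        simp only [Finset.sum_filter]
    _ ≤ ∑ _p ∈ P, 24 * pairSumConst g * 4 ^ (2 * alph g) * (n : ℝ) ^ (-(2 * alph g - 1)) := by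
        refine Finset.sum_le_sum fun p hp => ?_
        rw [hP, Finset.mem_product, Finset.mem_filter] at hp
        refine sum_TnInd_constrained_le (c := n - ∑ a ∈ p.2, a) hg0 hp.1.2 _
          (fun x hx => hFmem x (Finset.mem_filter.1 hx).1) fun x hx => ?_
        have := (Finset.mem_filter.1 hx).2
        omega
    _ = P.card * (24 * pairSumConst g * 4 ^ (2 * alph g) *
          (n : ℝ) ^ (-(2 * alph g - 1))) := by
        rw [Finset.sum_const, nsmul_eq_mul]
    _ ≤ 2 ^ (2 * g + 1) * 2 ^ (2 * g + 4) * (24 * pairSumConst g * 4 ^ (2 * alph g) *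
          (n : ℝ) ^ (-(2 * alph g - 1))) := by
        gcongr
    _ = _ := by ring
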